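/- Suppose E satisfies the Palais–Smale condition, let X_N ⊆ X be a closed subspace, and let η : X_N → [0,∞) be an error indicator such that ‖E'(v)‖_{X*} ≤ C η(v) for all v ∈ X_N, with a constant C > 0. Let γ > 0 and let {w^k}_{k≥0} ⊂ X_N be a sequence such that ‖R_N(w^k)‖ → 0 as k → ∞, γ η(w^k) ≤ ‖R_N(w^k)‖ for all sufficiently large k, and {E(w^k)} is bounded in ℝ. Then {w^k} converges to the set C_E = {w ∈ X : E'(w) = 0} of critical points of E, in the sense that inf_{y∈C_E} ‖w^k − y‖ → 0 as k → ∞. -/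

import Mathlib

open Filter
open scoped RealInnerProductSpace

/-- **Convergence to the critical set when the while loop does not terminate**
(Theorem (I) of the LMMG convergence analysis): if the discrete residuals tend to zero and
eventually dominate `γ` times the error indicator, which in turn controls the dual norm of
`E'`, then the sequence converges to the set of critical points of `E`. -/
theorem lmmg_convergence_nonterminating_loop
    {X : Type*} [NormedAddCommGroup X] [InnerProductSpace ℝ X] [CompleteSpace X]
    (E : X → ℝ) (E' : X → X →L[ℝ] ℝ)
    (hE : ∀ x, HasFDerivAt E (E' x) x) (hE' : Continuous E')
    (PS : ∀ u : ℕ → X, (∃ M : ℝ, ∀ k, |E (u k)| ≤ M) →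
      Tendsto (fun k => ‖E' (u k)‖) atTop (nhds 0) →
      ∃ φ : ℕ → ℕ, StrictMono φ ∧ ∃ x : X, Tendsto (u ∘ φ) atTop (nhds x))
    (XN : Submodule ℝ X) (hXN : IsClosed (XN : Set X))
    (η : X → ℝ) (hηnonneg : ∀ v ∈ XN, 0 ≤ η v)
    (C : ℝ) (hC : 0 < C)
    (hindicator : ∀ v ∈ XN, ‖E' v‖ ≤ C * η v)
    (R : X → X) (hRmem : ∀ x : X, R x ∈ XN)
    (hR : ∀ x : X, ∀ v ∈ XN, ⟪R x, v⟫ = E' x v)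
    (γ : ℝ) (hγ : 0 < γ)
    (w : ℕ → X) (hwmem : ∀ k, w k ∈ XN)
    (hRtendsto : Tendsto (fun k => ‖R (w k)‖) atTop (nhds 0))
    (hγη : ∃ K : ℕ, ∀ k ≥ K, γ * η (w k) ≤ ‖R (w k)‖)
    (hEbdd : ∃ M : ℝ, ∀ k, |E (w k)| ≤ M) :
    Tendsto (fun k => Metric.infDist (w k) {y : X | E' y = 0}) atTop (nhds 0) := by
  obtain ⟨K, hK⟩ := hγη
  obtain ⟨M, hM⟩ := hEbdd
  have hderiv : Tendsto (fun k => ‖E' (w k)‖) atTop (nhds 0) := by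
    have hbound : Tendsto (fun k => C / γ * ‖R (w k)‖) atTop (nhds 0) := by
      simpa using hRtendsto.const_mul (C / γ)
    refine squeeze_zero' (Eventually.of_forall fun k => norm_nonneg _) ?_ hbound
    filter_upwards [eventually_ge_atTop K] with k hk
    calc ‖E' (w k)‖ ≤ C * η (w k) := hindicator _ (hwmem k)
      _ = C / γ * (γ * η (w k)) := by field_simp
      _ ≤ C / γ * ‖R (w k)‖ := by gcongr; exact hK k hk
  refine tendsto_of_subseq_tendsto fun ns hns => ?_
  have hsub : Tendsto (fun k => ‖E' (w (ns k))‖) atTop (nhds 0) := hderiv.comp hns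
  obtain ⟨φ, hφ, x, hx⟩ := PS (w ∘ ns) ⟨M, fun k => hM _⟩ hsub
  have hcrit : x ∈ {y : X | E' y = 0} := norm_eq_zero.mp <|
    tendsto_nhds_unique ((hE'.norm.tendsto x).comp hx) (hsub.comp hφ.tendsto_atTop)
  refine ⟨φ, ?_⟩
  have hlim := ((Metric.continuous_infDist_pt {y : X | E' y = 0}).tendsto x).comp hx
  rwa [Metric.infDist_zero_of_mem hcrit] at hlim
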